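/- arXiv:quant-ph/0303088 — 2 statements merged into one kernel-verified Lean document; each statement's English description precedes it below -/
import Mathlib

section
/- Under the hypotheses of the previous statement, measuring in the computational basis achieves mutual information exactly (1/2) log₂ d on the ensemble {1/(2d), U_t|k⟩}, hence the accessible information of this ensemble equals (1/2) log₂ d. -/
open scoped BigOperators Classical ComplexOrder
open Matrix Kronecker

noncomputable section

/-- Shannon entropy (base 2) of a finitely supported nonnegative function. -/
def H2 {α : Type} [Fintype α] (p : α → ℝ) : ℝ := ∑ x, -(p x * Real.logb 2 (p x))

/-- Marginal on the first factor. -/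
def margA {α β : Type} [Fintype α] [Fintype β] (p : α × β → ℝ) : α → ℝ :=
  fun a => ∑ b, p (a, b)

/-- Marginal on the second factor. -/
def margB {α β : Type} [Fintype α] [Fintype β] (p : α × β → ℝ) : β → ℝ :=
  fun b => ∑ a, p (a, b)

/-- Classical mutual information (base 2) of a joint distribution. -/
def mi {α β : Type} [Fintype α] [Fintype β] (p : α × β → ℝ) : ℝ :=
  H2 (margA p) + H2 (margB p) - H2 p

/-- Kullback–Leibler divergence in bits. -/
def klDiv {α : Type} [Fintype α] (ν μ : α → ℝ) : ℝ :=
  ∑ x, ν x * Real.logb 2 (ν x / μ x)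

/-- ℓ₁ distance between two functions. -/
def l1 {α : Type} [Fintype α] (ν μ : α → ℝ) : ℝ := ∑ x, |ν x - μ x|

/-- `p` is a probability distribution. -/
def IsProb {α : Type} [Fintype α] (p : α → ℝ) : Prop :=
  (∀ x, 0 ≤ p x) ∧ ∑ x, p x = 1

/-- Probability of an event. -/
def prE {Ω : Type} [Fintype Ω] (p : Ω → ℝ) (E : Ω → Prop) : ℝ :=
  ∑ ω, if E ω then p ω else 0

/-- Conditional distribution given an event. -/
def condP {Ω : Type} [Fintype Ω] (p : Ω → ℝ) (E : Ω → Prop) : Ω → ℝ :=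
  fun ω => if E ω then p ω / prE p E else 0

/-- Distribution of a random variable. -/
def distOf {Ω α : Type} [Fintype Ω] (p : Ω → ℝ) (X : Ω → α) : α → ℝ :=
  fun x => prE p (fun ω => X ω = x)

/-- Joint distribution of a pair of random variables. -/
def jointOf {Ω α β : Type} [Fintype Ω] (p : Ω → ℝ) (X : Ω → α) (Y : Ω → β)
    [Fintype α] [Fintype β] : α × β → ℝ :=
  fun xy => prE p (fun ω => X ω = xy.1 ∧ Y ω = xy.2)

/-- Mutual information between two random variables on a finite probability space. -/
def miRV {Ω α β : Type} [Fintype Ω] [Fintype α] [Fintype β]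
    (p : Ω → ℝ) (X : Ω → α) (Y : Ω → β) : ℝ :=
  mi (jointOf p X Y)



/-- A density matrix: positive semidefinite with unit trace. -/
def IsDensity {n : Type} [Fintype n] [DecidableEq n] (ρ : Matrix n n ℂ) : Prop :=
  ρ.PosSemidef ∧ ρ.trace = 1

/-- A POVM: positive semidefinite elements summing to the identity. -/
def IsPOVM {n ι : Type} [Fintype n] [DecidableEq n] [Fintype ι]
    (M : ι → Matrix n n ℂ) : Prop :=
  (∀ i, (M i).PosSemidef) ∧ ∑ i, M i = 1

/-- Partial trace over the second (Bob) factor: Alice's reduced state. -/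
def trOutB {A B : Type} [Fintype A] [Fintype B]
    (ρ : Matrix (A × B) (A × B) ℂ) : Matrix A A ℂ :=
  Matrix.of fun a a' => ∑ b, ρ (a, b) (a', b)

/-- Partial trace over the first (Alice) factor: Bob's reduced state. -/
def trOutA {A B : Type} [Fintype A] [Fintype B]
    (ρ : Matrix (A × B) (A × B) ℂ) : Matrix B B ℂ :=
  Matrix.of fun b b' => ∑ a, ρ (a, b) (a, b')

/-- von Neumann entropy in bits (via the eigenvalues of a Hermitian matrix). -/
def vN {n : Type} [Fintype n] [DecidableEq n] (ρ : Matrix n n ℂ) : ℝ :=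
  if h : ρ.IsHermitian then ∑ i, -(h.eigenvalues i * Real.logb 2 (h.eigenvalues i)) else 0

/-- Quantum mutual information `S(ρ_A) + S(ρ_B) − S(ρ_AB)` in bits. -/
def Iq {A B : Type} [Fintype A] [DecidableEq A] [Fintype B] [DecidableEq B]
    (ρ : Matrix (A × B) (A × B) ℂ) : ℝ :=
  vN (trOutB ρ) + vN (trOutA ρ) - vN ρ

/-- Trace norm (sum of singular values). -/
def traceNorm {n : Type} [Fintype n] [DecidableEq n] (M : Matrix n n ℂ) : ℝ :=
  ∑ i, Real.sqrt ((Matrix.posSemidef_conjTranspose_mul_self M).1.eigenvalues i)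

/-- Outcome distribution of a local measurement `M_A ⊗ M_B` on a bipartite state. -/
def outcomeProb {A B J K : Type} [Fintype A] [Fintype B] [Fintype J] [Fintype K]
    (ρ : Matrix (A × B) (A × B) ℂ)
    (MA : J → Matrix A A ℂ) (MB : K → Matrix B B ℂ) : J × K → ℝ :=
  fun jk => ((MA jk.1 ⊗ₖ MB jk.2) * ρ).trace.re

/-- The set of classical mutual informations achievable by local POVMs. -/
def IcSet {A B : Type} [Fintype A] [DecidableEq A] [Fintype B] [DecidableEq B]
    (ρ : Matrix (A × B) (A × B) ℂ) : Set ℝ :=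
  {r | ∃ (J K : Type) (_ : Fintype J) (_ : Fintype K)
        (MA : J → Matrix A A ℂ) (MB : K → Matrix B B ℂ),
        IsPOVM MA ∧ IsPOVM MB ∧ r = mi (outcomeProb ρ MA MB)}

/-- Maximal classical mutual information obtainable by local measurements. -/
def Ic {A B : Type} [Fintype A] [DecidableEq A] [Fintype B] [DecidableEq B]
    (ρ : Matrix (A × B) (A × B) ℂ) : ℝ :=
  sSup (IcSet ρ)

/-- Rank-one projector (outer product) `|v⟩⟨v|`. -/
def outer {n : Type} [Fintype n] (v : n → ℂ) : Matrix n n ℂ :=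
  Matrix.of fun i i' => v i * star (v i')

/-- The expectation `⟨φ|M|φ⟩` (real part). -/
def qexp {n : Type} [Fintype n] (φ : n → ℂ) (M : Matrix n n ℂ) : ℝ :=
  (∑ i, ∑ i', star (φ i) * M i i' * φ i').re

/-- The set of mutual informations between the ensemble label and the outcome of a POVM. -/
def IaccSet {n I : Type} [Fintype n] [DecidableEq n] [Fintype I]
    (p : I → ℝ) (η : I → Matrix n n ℂ) : Set ℝ :=
  {r | ∃ (J : Type) (_ : Fintype J) (M : J → Matrix n n ℂ), IsPOVM M ∧
        r = mi (fun ij : I × J => p ij.1 * ((M ij.2) * (η ij.1)).trace.re)}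

/-- Accessible information of an ensemble. -/
def Iacc {n I : Type} [Fintype n] [DecidableEq n] [Fintype I]
    (p : I → ℝ) (η : I → Matrix n n ℂ) : ℝ :=
  sSup (IaccSet p η)

/-- Matrix logarithm (base 2) of a Hermitian matrix, via spectral decomposition. -/
def matLog {n : Type} [Fintype n] [DecidableEq n] (M : Matrix n n ℂ) : Matrix n n ℂ :=
  if h : M.IsHermitian then
    (h.eigenvectorUnitary : Matrix n n ℂ) *
      Matrix.diagonal (fun i => (Real.logb 2 (h.eigenvalues i) : ℂ)) *
      star (h.eigenvectorUnitary : Matrix n n ℂ)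
  else 0

/-- Quantum relative entropy `Tr ν log₂ ν − Tr ν log₂ μ`. -/
def qRelEnt {n : Type} [Fintype n] [DecidableEq n] (ν μ : Matrix n n ℂ) : ℝ :=
  ((ν * matLog ν).trace - (ν * matLog μ).trace).re

/-- Three lines inequality for a finite sum of exponentials, differentiated at the left end. -/
theorem re_sum_mul_le_of_three_lines {ι : Type} [Fintype ι] (a : ι → ℂ) (s : ι → ℝ) {T K : ℝ}
    (hT : 0 < T) (hK : 0 < K) (hsum : ∑ i, a i = T)
    (h₀ : ∀ z : ℂ, z.re = 0 → ‖∑ i, a i * Complex.exp (z * s i)‖ ≤ T)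
    (h₁ : ∀ z : ℂ, z.re = 1 → ‖∑ i, a i * Complex.exp (z * s i)‖ ≤ K) :
    (∑ i, a i * s i).re ≤ T * Real.log (K / T) := by
  set F : ℂ → ℂ := fun z => ∑ i, a i * Complex.exp (z * s i) with hF
  have hdiff : Differentiable ℂ F := by fun_prop
  have hbdd : BddAbove ((norm ∘ F) '' Complex.HadamardThreeLines.verticalClosedStrip 0 1) := by
    refine ⟨∑ i, ‖a i‖ * Real.exp |s i|, ?_⟩
    rintro _ ⟨z, hz, rfl⟩
    refine (norm_sum_le _ _).trans (Finset.sum_le_sum fun i _ => ?_)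
    rw [norm_mul, Complex.norm_exp]
    have hz' : 0 ≤ z.re ∧ z.re ≤ 1 := hz
    gcongr
    rw [Complex.re_mul_ofReal]
    calc z.re * s i ≤ z.re * |s i| := by gcongr; exacts [hz'.1, le_abs_self _]
      _ ≤ 1 * |s i| := by gcongr; exact hz'.2
      _ = |s i| := one_mul _
  set g : ℝ → ℝ := fun θ => (F θ).re - T * Real.exp (θ * Real.log (K / T)) with hg
  have hle : ∀ θ : ℝ, 0 ≤ θ → θ ≤ 1 → g θ ≤ 0 := by
    intro θ hθ₀ hθ₁
    have h := Complex.HadamardThreeLines.norm_le_interp_of_mem_verticalClosedStrip₀₁' F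
      (z := (θ : ℂ)) (a := T) (b := K) (by simpa [Complex.HadamardThreeLines.verticalClosedStrip]
        using ⟨hθ₀, hθ₁⟩) hdiff.diffContOnCl hbdd
      (fun z hz => h₀ z hz) (fun z hz => h₁ z hz)
    rw [Complex.ofReal_re] at h
    have hexp : T ^ (1 - θ) * K ^ θ = T * Real.exp (θ * Real.log (K / T)) := by
      rw [Real.rpow_def_of_pos hT, Real.rpow_def_of_pos hK, Real.log_div hK.ne' hT.ne']
      nth_rewrite 2 [← Real.exp_log hT]
      rw [← Real.exp_add, ← Real.exp_add]
      congr 1; ring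
    have := (Complex.re_le_norm (F θ)).trans h
    simp only [hg]; linarith
  have hg0 : g 0 = 0 := by
    simp only [hg, hF, Complex.ofReal_zero, zero_mul, Complex.exp_zero, mul_one, hsum]
    simp
  have hderF : HasDerivAt F (∑ i, a i * s i) ((0 : ℝ) : ℂ) := by
    refine HasDerivAt.fun_sum fun i _ => ?_
    have := ((hasDerivAt_mul_const (x := ((0 : ℝ) : ℂ)) (s i : ℂ)).cexp).const_mul (a i)
    simpa using this
  have hderg : HasDerivAt g ((∑ i, a i * s i).re - T * Real.log (K / T)) 0 := by
    refine hderF.real_of_complex.sub ?_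
    have := ((hasDerivAt_mul_const (x := (0 : ℝ)) (Real.log (K / T))).exp).const_mul T
    simpa using this
  have hlim := hderg.tendsto_slope_zero_right
  refine sub_nonpos.mp (le_of_tendsto hlim ?_)
  filter_upwards [Ioo_mem_nhdsGT (zero_lt_one (α := ℝ))] with t ht
  rw [zero_add, hg0, sub_zero, smul_eq_mul]
  exact mul_nonpos_of_nonneg_of_nonpos (inv_nonneg.mpr ht.1.le) (hle t ht.1.le ht.2.le)

theorem sum_norm_sq_mul_unitary {m n : Type} [Fintype m] [Fintype n] [DecidableEq n]
    (X : Matrix m n ℂ) {V : Matrix n n ℂ} (hV : V ∈ Matrix.unitaryGroup n ℂ) :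
    ∑ j, ∑ l, ‖(X * V) l j‖ ^ 2 = ∑ j, ∑ l, ‖X l j‖ ^ 2 := by
  have htrace (Y : Matrix m n ℂ) : ((∑ j, ∑ l, ‖Y l j‖ ^ 2 : ℝ) : ℂ) = (Y * Yᴴ).trace := by
    rw [Finset.sum_comm]
    simp [Matrix.trace, Matrix.mul_apply, Complex.mul_conj']
  have hmul : (X * V) * (X * V)ᴴ = X * Xᴴ := by
    rw [Matrix.conjTranspose_mul, Matrix.mul_assoc, ← Matrix.mul_assoc V,
      ← Matrix.star_eq_conjTranspose V, Matrix.mem_unitaryGroup_iff.mp hV, Matrix.one_mul]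
  exact_mod_cast (htrace (X * V)).trans (hmul ▸ (htrace X).symm)

theorem exp_half_log_mul_sqrt {x : ℝ} (hx : 0 ≤ x) :
    Real.exp (Real.log x / 2) * √x = x := by
  rcases hx.eq_or_lt with rfl | hx
  · simp
  · rw [← Real.log_sqrt hx.le, Real.exp_log (Real.sqrt_pos.mpr hx), Real.mul_self_sqrt hx.le]

/-- The Maassen–Uffink entropic uncertainty relation for the unnormalised state `Bᴴ * B`. -/
theorem sum_mul_log_add_sum_mul_log_le {n : Type} [Fintype n] [DecidableEq n]
    (B : Matrix n n ℂ) {V : Matrix n n ℂ} (hV : V ∈ Matrix.unitaryGroup n ℂ) {c : ℝ}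
    (hc : 0 < c) (hVc : ∀ i j, ‖V i j‖ ≤ c) {T : ℝ} (hT : ∑ k, ∑ l, ‖B l k‖ ^ 2 = T) :
    ∑ j, (∑ l, ‖(B * V) l j‖ ^ 2) * Real.log (∑ l, ‖(B * V) l j‖ ^ 2) +
      ∑ k, (∑ l, ‖B l k‖ ^ 2) * Real.log (∑ l, ‖B l k‖ ^ 2) ≤ 2 * (T * Real.log (c * T)) := by
  set C := B * V with hC
  set p : n → ℝ := fun j => ∑ l, ‖C l j‖ ^ 2 with hp
  set q : n → ℝ := fun k => ∑ l, ‖B l k‖ ^ 2 with hq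
  have hp0 (j) : 0 ≤ p j := Finset.sum_nonneg fun _ _ => by positivity
  have hq0 (k) : 0 ≤ q k := Finset.sum_nonneg fun _ _ => by positivity
  have hqT : ∑ k, q k = T := hT
  have hpT : ∑ j, p j = T := by
    rw [← hqT]
    exact sum_norm_sq_mul_unitary B hV
  have hT0 : 0 ≤ T := hqT ▸ Finset.sum_nonneg fun k _ => hq0 k
  rcases hT0.eq_or_lt with h | hTpos
  · rw [← h] at hpT hqT
    have hp' := (Finset.sum_eq_zero_iff_of_nonneg fun j _ => hp0 j).mp hpT
    have hq' := (Finset.sum_eq_zero_iff_of_nonneg fun j _ => hq0 j).mp hqT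
    change ∑ j, p j * Real.log (p j) + ∑ k, q k * Real.log (q k) ≤ _
    rw [Finset.sum_eq_zero fun j hj => by rw [hp' j hj, zero_mul],
      Finset.sum_eq_zero fun j hj => by rw [hq' j hj, zero_mul], ← h]
    simp
  have hB : C * Vᴴ = B := by
    rw [hC, Matrix.mul_assoc, ← Matrix.star_eq_conjTranspose,
      Matrix.mem_unitaryGroup_iff.mp hV, Matrix.mul_one]
  set a : n → n → ℂ := fun j k => star (V k j) * ∑ l, star (B l k) * C l j with ha
  have hap (j) : ∑ k, a j k = p j := by
    simp only [ha, hp, Finset.mul_sum]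
    rw [Finset.sum_comm]
    push_cast
    refine Finset.sum_congr rfl fun l _ => ?_
    rw [← Complex.conj_mul', ← Complex.star_def]
    nth_rewrite 2 [hC]
    rw [Matrix.mul_apply, star_sum, Finset.sum_mul]
    refine Finset.sum_congr rfl fun k _ => ?_
    rw [star_mul']; ring
  have haq (k) : ∑ j, a j k = q k := by
    simp only [ha, hq, Finset.mul_sum]
    rw [Finset.sum_comm]
    push_cast
    refine Finset.sum_congr rfl fun l _ => ?_
    rw [← Complex.conj_mul', ← Complex.star_def]
    nth_rewrite 3 [← hB]
    rw [Matrix.mul_apply, Finset.mul_sum]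
    refine Finset.sum_congr rfl fun j _ => ?_
    rw [Matrix.conjTranspose_apply]; ring
  have hCS (j k) : ‖∑ l, star (B l k) * C l j‖ ≤ √(q k) * √(p j) := by
    refine (norm_sum_le _ _).trans ?_
    simp only [norm_mul, norm_star]
    exact Real.sum_mul_le_sqrt_mul_sqrt _ _ _
  have key := re_sum_mul_le_of_three_lines (ι := n × n) (fun x => a x.1 x.2)
    (fun x => Real.log (p x.1) / 2 + Real.log (q x.2) / 2) (K := c * T ^ 2) hTpos (by positivity)
    ?_ ?_ ?_
  · rw [show c * T ^ 2 / T = c * T by field_simp] at key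
    have hder : ∑ x : n × n, a x.1 x.2 *
        ((Real.log (p x.1) / 2 + Real.log (q x.2) / 2 : ℝ) : ℂ) =
        (((∑ j, p j * Real.log (p j) + ∑ k, q k * Real.log (q k)) / 2 : ℝ) : ℂ) := by
      rw [Fintype.sum_prod_type]
      simp only [Complex.ofReal_add, mul_add, Finset.sum_add_distrib]
      rw [Finset.sum_comm (f := fun j k => a j k * ((Real.log (q k) / 2 : ℝ) : ℂ))]
      simp only [← Finset.sum_mul, hap, haq]
      push_cast
      rw [add_div, Finset.sum_div, Finset.sum_div]
      simp only [mul_div_assoc]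
    rw [hder, Complex.ofReal_re] at key
    change ∑ j, p j * Real.log (p j) + ∑ k, q k * Real.log (q k) ≤ _
    linarith
  · rw [Fintype.sum_prod_type]
    simp only [hap]
    exact_mod_cast hpT
  · intro z hz
    have hα (x : ℝ) : ‖Complex.exp (z * x)‖ = 1 := by simp [Complex.norm_exp, hz]
    set D : Matrix n n ℂ := Matrix.of fun l k =>
      star (Complex.exp (z * ((Real.log (q k) / 2 : ℝ) : ℂ))) * B l k with hD
    have hsum : ∑ x : n × n, a x.1 x.2 *
        Complex.exp (z * ((Real.log (p x.1) / 2 + Real.log (q x.2) / 2 : ℝ) : ℂ)) =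
        ∑ j, ∑ l, C l j * Complex.exp (z * ((Real.log (p j) / 2 : ℝ) : ℂ)) *
          star ((D * V) l j) := by
      rw [Fintype.sum_prod_type]
      refine Finset.sum_congr rfl fun j _ => ?_
      simp only [ha, Matrix.mul_apply, star_sum, Finset.mul_sum, Finset.sum_mul]
      rw [Finset.sum_comm]
      refine Finset.sum_congr rfl fun l _ => Finset.sum_congr rfl fun k _ => ?_
      simp only [hD, Matrix.of_apply, star_mul', star_star]
      rw [Complex.ofReal_add, mul_add, Complex.exp_add]
      ring
    rw [hsum]
    have hDT : ∑ j, ∑ l, ‖(D * V) l j‖ ^ 2 = T := by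
      rw [sum_norm_sq_mul_unitary D hV, ← hqT]
      refine Finset.sum_congr rfl fun k _ => Finset.sum_congr rfl fun l _ => ?_
      rw [hD, Matrix.of_apply, norm_mul, norm_star, hα, one_mul]
    calc ‖∑ j, ∑ l, C l j * Complex.exp (z * ((Real.log (p j) / 2 : ℝ) : ℂ)) *
          star ((D * V) l j)‖
        ≤ ∑ j, ∑ l, (‖C l j‖ ^ 2 / 2 + ‖(D * V) l j‖ ^ 2 / 2) := by
          refine norm_sum_le_of_le _ fun j _ => norm_sum_le_of_le _ fun l _ => ?_
          rw [norm_mul, norm_mul, hα, mul_one, norm_star]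
          nlinarith [sq_nonneg (‖C l j‖ - ‖(D * V) l j‖)]
      _ = T := by
          simp only [Finset.sum_add_distrib, ← Finset.sum_div]
          rw [hDT]
          change (∑ j, p j) / 2 + _ = _
          rw [hpT]; ring
  · intro z hz
    have hexp (x : ℝ) : ‖Complex.exp (z * x)‖ = Real.exp x := by
      simp [Complex.norm_exp, hz]
    calc _ ≤ ∑ x : n × n, c * (p x.1 * q x.2) := by
          refine norm_sum_le_of_le _ fun x _ => ?_
          rw [norm_mul, hexp, ha, norm_mul, norm_star, Real.exp_add]
          calc _ ≤ c * (√(q x.2) * √(p x.1)) *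
                (Real.exp (Real.log (p x.1) / 2) * Real.exp (Real.log (q x.2) / 2)) := by
                gcongr
                exacts [hVc _ _, hCS _ _]
            _ = c * ((Real.exp (Real.log (p x.1) / 2) * √(p x.1)) *
                (Real.exp (Real.log (q x.2) / 2) * √(q x.2))) := by ring
            _ = _ := by rw [exp_half_log_mul_sqrt (hp0 _), exp_half_log_mul_sqrt (hq0 _)]
      _ = c * T ^ 2 := by
          rw [← Finset.mul_sum, Fintype.sum_prod_type]
          simp only [← Finset.mul_sum, ← Finset.sum_mul, hpT, hqT]
          ring

/-- Mutual information of a joint distribution whose first marginal is uniform. -/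
theorem mi_const_mul {α β : Type} [Fintype α] [Fintype β] (r : α → β → ℝ) {c : ℝ} (hc : c ≠ 0)
    (hr : ∀ x, ∑ j, r x j = 1) (hcard : (Fintype.card α : ℝ) * c = 1) :
    mi (fun x : α × β => c * r x.1 x.2) = -Real.logb 2 c +
      c * ∑ j, (∑ x, r x j * Real.logb 2 (r x j) -
        (∑ x, r x j) * Real.logb 2 (∑ x, r x j)) := by
  have hlog (y : ℝ) : -(c * y * Real.logb 2 (c * y)) =
      -(c * Real.logb 2 c) * y - c * (y * Real.logb 2 y) := by
    rcases eq_or_ne y 0 with rfl | hy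
    · simp
    · rw [Real.logb_mul hc hy]; ring
  have hsum : ∑ j, ∑ x, r x j = Fintype.card α := by
    rw [Finset.sum_comm]; simp [hr]
  simp only [mi, H2, margA, margB, ← Finset.mul_sum, hr, mul_one]
  rw [Fintype.sum_prod_type_right]
  simp only [hlog, Finset.sum_sub_distrib, ← Finset.mul_sum, hsum, Finset.sum_const,
    Finset.card_univ, nsmul_eq_mul]
  linear_combination (-Real.logb 2 c) * hcard

theorem trace_conjTranspose_mul_self_mul_outer {m n : Type} [Fintype m] [Fintype n]
    (B : Matrix m n ℂ) (v : n → ℂ) :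
    (Bᴴ * B * outer v).trace = ((∑ l, ‖(B *ᵥ v) l‖ ^ 2 : ℝ) : ℂ) := by
  have houter : outer v = Matrix.vecMulVec v (star v) := rfl
  rw [houter, Matrix.mul_vecMulVec, Matrix.trace_vecMulVec, ← Matrix.mulVec_mulVec,
    dotProduct_comm, Matrix.dotProduct_mulVec, ← Matrix.star_mulVec]
  simp [dotProduct, Complex.conj_mul']

theorem trace_outer {n : Type} [Fintype n] (v : n → ℂ) :
    (outer v).trace = ((∑ i, ‖v i‖ ^ 2 : ℝ) : ℂ) := by
  simp [Matrix.trace, outer, Complex.mul_conj']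

theorem logb_one_div_two_mul {x : ℝ} (hx : 0 < x) :
    Real.logb 2 (1 / (2 * x)) = -1 - Real.logb 2 x := by
  rw [one_div, Real.logb_inv, Real.logb_mul two_ne_zero hx.ne', Real.logb_self_eq_one one_lt_two]
  ring

section MutuallyUnbiased

variable {d : ℕ} {U : Fin 2 → Matrix (Fin d) (Fin d) ℂ}

theorem sum_norm_sq_col_eq_one (hd : 1 ≤ d) (hU0 : U 0 = 1)
    (hmub : ∀ i k, ‖U 1 i k‖ ^ 2 = 1 / d) (t : Fin 2) (k : Fin d) :
    ∑ i, ‖U t i k‖ ^ 2 = 1 := by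
  have hd' : (d : ℝ) ≠ 0 := by positivity
  fin_cases t
  · simp [hU0, Matrix.one_apply, apply_ite]
  · simp [hmub, hd']

theorem mi_computational_basis (hd : 1 ≤ d) (hU0 : U 0 = 1)
    (hmub : ∀ i k, ‖U 1 i k‖ ^ 2 = 1 / d) :
    mi (fun kj : (Fin d × Fin 2) × Fin d =>
        (1 / (2 * d)) * ‖U kj.1.2 kj.2 kj.1.1‖ ^ 2) = (1 / 2) * Real.logb 2 d := by
  have hd' : (0 : ℝ) < d := by positivity
  rw [mi_const_mul (fun (x : Fin d × Fin 2) j => ‖U x.2 j x.1‖ ^ 2) (by positivity)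
    (fun x => sum_norm_sq_col_eq_one hd hU0 hmub x.2 x.1) (by simp; field_simp)]
  have hS (j : Fin d) : ∑ x : Fin d × Fin 2, ‖U x.2 j x.1‖ ^ 2 = 2 := by
    rw [Fintype.sum_prod_type_right, Fin.sum_univ_two]
    simp only [hU0, hmub, Matrix.one_apply]
    simp [apply_ite, hd'.ne']
    norm_num
  have hR (j : Fin d) : ∑ x : Fin d × Fin 2, ‖U x.2 j x.1‖ ^ 2 *
      Real.logb 2 (‖U x.2 j x.1‖ ^ 2) = -Real.logb 2 d := by
    rw [Fintype.sum_prod_type_right, Fin.sum_univ_two]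
    simp only [hU0, hmub, Matrix.one_apply]
    rw [Finset.sum_eq_zero fun k _ => by split_ifs <;> simp]
    simp [hd'.ne']
  simp only [hS, hR, Real.logb_self_eq_one one_lt_two, logb_one_div_two_mul hd', Finset.sum_const,
    Finset.card_univ, Fintype.card_fin, nsmul_eq_mul]
  field_simp
  ring

theorem sum_mul_logb_sub_le (hd : 1 ≤ d) (hunitary : U 1 ∈ Matrix.unitaryGroup (Fin d) ℂ)
    (hU0 : U 0 = 1) (hmub : ∀ i k, ‖U 1 i k‖ ^ 2 = 1 / d) (B : Matrix (Fin d) (Fin d) ℂ) :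
    ∑ x : Fin d × Fin 2, (∑ l, ‖(B * U x.2) l x.1‖ ^ 2) *
        Real.logb 2 (∑ l, ‖(B * U x.2) l x.1‖ ^ 2) -
      (∑ x : Fin d × Fin 2, ∑ l, ‖(B * U x.2) l x.1‖ ^ 2) *
        Real.logb 2 (∑ x : Fin d × Fin 2, ∑ l, ‖(B * U x.2) l x.1‖ ^ 2) ≤
      (∑ x : Fin d × Fin 2, ∑ l, ‖(B * U x.2) l x.1‖ ^ 2) * (-1 - 1 / 2 * Real.logb 2 d) := by
  have hd' : (0 : ℝ) < d := by positivity
  obtain ⟨T, hT⟩ : ∃ T, ∑ k, ∑ l, ‖B l k‖ ^ 2 = T := ⟨_, rfl⟩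
  have hT0 : 0 ≤ T := hT ▸ by positivity
  have hS : ∑ x : Fin d × Fin 2, ∑ l, ‖(B * U x.2) l x.1‖ ^ 2 = 2 * T := by
    rw [Fintype.sum_prod_type_right, Fin.sum_univ_two]
    dsimp only
    rw [hU0, Matrix.mul_one, sum_norm_sq_mul_unitary B hunitary, hT, two_mul]
  have hnorm (i k) : ‖U 1 i k‖ ≤ √(1 / d) := by
    rw [← hmub i k, Real.sqrt_sq (norm_nonneg _)]
  have key := sum_mul_log_add_sum_mul_log_le B hunitary (Real.sqrt_pos.mpr (by positivity))
    hnorm hT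
  have hR : ∑ x : Fin d × Fin 2, (∑ l, ‖(B * U x.2) l x.1‖ ^ 2) *
      Real.logb 2 (∑ l, ‖(B * U x.2) l x.1‖ ^ 2) ≤ 2 * (T * Real.logb 2 (√(1 / d) * T)) := by
    rw [Fintype.sum_prod_type_right, Fin.sum_univ_two]
    dsimp only
    rw [hU0, Matrix.mul_one, add_comm]
    simp only [Real.logb, ← mul_div_assoc, ← Finset.sum_div, ← add_div]
    exact div_le_div_of_nonneg_right key (Real.log_nonneg one_le_two)
  rw [hS]
  refine (sub_le_sub_right hR _).trans_eq ?_
  rcases hT0.eq_or_lt with rfl | hTpos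
  · simp
  · rw [Real.logb_mul (by positivity) hTpos.ne', Real.logb_mul two_ne_zero hTpos.ne',
      Real.logb_self_eq_one one_lt_two, Real.sqrt_eq_rpow, Real.logb_rpow_eq_mul_logb_of_pos
      (by positivity), one_div (d : ℝ), Real.logb_inv]
    ring

theorem mi_povm_le (hd : 1 ≤ d) (hunitary : U 1 ∈ Matrix.unitaryGroup (Fin d) ℂ)
    (hU0 : U 0 = 1) (hmub : ∀ i k, ‖U 1 i k‖ ^ 2 = 1 / d) {J : Type} [Fintype J]
    {M : J → Matrix (Fin d) (Fin d) ℂ} (hM : IsPOVM M) :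
    mi (fun ij : (Fin d × Fin 2) × J => (1 / (2 * d)) *
      (M ij.2 * outer (fun i => U ij.1.2 i ij.1.1)).trace.re) ≤ (1 / 2) * Real.logb 2 d := by
  have hd' : (0 : ℝ) < d := by positivity
  obtain ⟨hpos, hone⟩ := hM
  have hfactor (j) : ∃ B : Matrix (Fin d) (Fin d) ℂ, M j = Bᴴ * B := by
    open scoped MatrixOrder in
    exact CStarAlgebra.nonneg_iff_eq_star_mul_self.mp (hpos j).nonneg
  choose B hB using hfactor
  have hrow (x : Fin d × Fin 2) :
      ∑ j, (M j * outer (fun i => U x.2 i x.1)).trace.re = 1 := by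
    rw [← Complex.re_sum, ← Matrix.trace_sum, ← Finset.sum_mul, hone, Matrix.one_mul, trace_outer,
      Complex.ofReal_re, sum_norm_sq_col_eq_one hd hU0 hmub]
  have hentry (x : Fin d × Fin 2) (j) : (M j * outer (fun i => U x.2 i x.1)).trace.re =
      ∑ l, ‖(B j * U x.2) l x.1‖ ^ 2 := by
    rw [hB, trace_conjTranspose_mul_self_mul_outer, Complex.ofReal_re]
    rfl
  have htotal : ∑ j, ∑ x : Fin d × Fin 2, ∑ l, ‖(B j * U x.2) l x.1‖ ^ 2 = 2 * d := by
    rw [Finset.sum_comm]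
    simp only [← hentry, hrow]
    simp [mul_comm]
  rw [mi_const_mul (fun (x : Fin d × Fin 2) j => (M j * outer (fun i => U x.2 i x.1)).trace.re)
    (by positivity) hrow (by simp; field_simp), logb_one_div_two_mul hd']
  simp only [hentry]
  calc _ ≤ -(-1 - Real.logb 2 d) + 1 / (2 * d) *
        ∑ j, (∑ x : Fin d × Fin 2, ∑ l, ‖(B j * U x.2) l x.1‖ ^ 2) *
          (-1 - 1 / 2 * Real.logb 2 d) := by
        gcongr with j
        exact sum_mul_logb_sub_le hd hunitary hU0 hmub (B j)
    _ = _ := by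
        rw [← Finset.sum_mul, htotal]
        field_simp
        ring

end MutuallyUnbiased

theorem isPOVM_single {n : Type} [Fintype n] [DecidableEq n] :
    IsPOVM (fun j : n => Matrix.single j j (1 : ℂ)) := by
  refine ⟨fun j => ?_, Matrix.sum_single_one⟩
  dsimp only
  rw [← Matrix.diagonal_single]
  exact Matrix.PosSemidef.diagonal fun i => by by_cases h : i = j <;> simp [h]

theorem trace_single_mul_outer {n : Type} [Fintype n] [DecidableEq n] (j : n) (v : n → ℂ) :
    (Matrix.single j j (1 : ℂ) * outer v).trace.re = ‖v j‖ ^ 2 := by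
  rw [Matrix.trace_single_mul]
  simp [outer, Complex.mul_conj', ← Complex.ofReal_pow]

/-- the computational-basis measurement extracts exactly `(1/2) log₂ d` bits
from the ensemble `{1/(2d), U_t|k⟩}`, and the accessible information equals `(1/2) log₂ d`. -/
theorem stmt_7 (d : ℕ) (hd : 1 ≤ d) (U : Fin 2 → Matrix (Fin d) (Fin d) ℂ)
    (hunitary : ∀ t, U t ∈ Matrix.unitaryGroup (Fin d) ℂ)
    (hU0 : U 0 = 1)
    (hmub : ∀ i k, ‖U 1 i k‖ ^ 2 = 1 / d) :
    mi (fun kj : (Fin d × Fin 2) × Fin d =>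
        (1 / (2 * d)) * ‖U kj.1.2 kj.2 kj.1.1‖ ^ 2) = (1 / 2) * Real.logb 2 d ∧
    Iacc (fun _ : Fin d × Fin 2 => 1 / (2 * d))
        (fun kt => outer (fun i => U kt.2 i kt.1)) = (1 / 2) * Real.logb 2 d := by
  have hmi := mi_computational_basis hd hU0 hmub
  refine ⟨hmi, IsGreatest.csSup_eq ⟨?_, ?_⟩⟩
  · refine ⟨Fin d, inferInstance, _, isPOVM_single, ?_⟩
    simp only [trace_single_mul_outer]
    exact hmi.symm
  · rintro _ ⟨J, _, M, hM, rfl⟩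
    exact mi_povm_le hd (hunitary 1) hU0 hmub hM

end
end

section
/- Let ρ be a bipartite density matrix, M_A ⊗ M_B a local POVM with joint outcome distribution p_{AB} on measuring ρ, with marginals p_A, p_B. Then the classical relative entropy D(p_{AB} ‖ p_A ⊗ p_B) is at most the quantum mutual information I_q(ρ) = S(ρ_A) + S(ρ_B) − S(ρ_{AB}). In particular I_c(ρ) ≤ I_q(ρ). -/
open scoped BigOperators Classical ComplexOrder
open Matrix Kronecker

noncomputable section

/-- The scalar relative entropy density `x log (x / y) - x + y` is an average of
`χ²`-divergences. -/
lemma integral_chiSq {x y : ℝ} (hx : 0 ≤ x) (hy : 0 ≤ y) (hxy : y = 0 → x = 0) :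
    IntervalIntegrable (fun t : ℝ => (1 - t) * ((x - y) ^ 2 / (t * x + (1 - t) * y)))
      MeasureTheory.volume 0 1 ∧
    ∫ t in (0 : ℝ)..1, (1 - t) * ((x - y) ^ 2 / (t * x + (1 - t) * y)) =
      x * Real.log (x / y) - x + y := by
  rcases hy.eq_or_lt with rfl | hy
  · simp [hxy rfl]
  let F : ℝ → ℝ := fun t => x * Real.log (t * x + (1 - t) * y) - t * (x - y)
  have hpos : ∀ t ∈ Set.Ioo (0 : ℝ) 1, 0 < t * x + (1 - t) * y := fun t ht => by
    have := mul_nonneg ht.1.le hx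
    have := mul_pos (sub_pos.2 ht.2) hy
    linarith
  have hcont : ContinuousOn F (Set.Icc 0 1) := by
    rcases hx.eq_or_lt with rfl | hx
    · simp only [F, zero_mul]
      fun_prop
    · refine (continuousOn_const.mul (ContinuousOn.log (by fun_prop) fun t ht => ?_)).sub
        (by fun_prop)
      rcases ht.1.eq_or_lt with rfl | h0
      · simpa using hy.ne'
      · have := mul_pos h0 hx
        have := mul_nonneg (sub_nonneg.2 ht.2) hy.le
        positivity
  have hderiv : ∀ t ∈ Set.Ioo (0 : ℝ) 1,
      HasDerivAt F ((1 - t) * ((x - y) ^ 2 / (t * x + (1 - t) * y))) t := fun t ht => by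
    have hu := (hpos t ht).ne'
    have h1 : HasDerivAt (fun t : ℝ => t * x + (1 - t) * y) (x - y) t :=
      (((hasDerivAt_id t).mul_const x).add
        (((hasDerivAt_id t).const_sub 1).mul_const y)).congr_deriv (by ring)
    refine (((h1.log hu).const_mul x).sub
      ((hasDerivAt_id t).mul_const (x - y))).congr_deriv ?_
    have h2 : (1 - t) * (x - y) = x - (t * x + (1 - t) * y) := by ring
    rw [pow_two, mul_div_assoc, ← mul_assoc, h2]
    generalize t * x + (1 - t) * y = u at hu
    field_simp
  have hint : IntervalIntegrable (fun t : ℝ => (1 - t) * ((x - y) ^ 2 / (t * x + (1 - t) * y)))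
      MeasureTheory.volume 0 1 := by
    rw [intervalIntegrable_iff_integrableOn_Ioc_of_le zero_le_one]
    refine intervalIntegral.integrableOn_deriv_of_nonneg hcont hderiv fun t ht => ?_
    have := hpos t ht
    have := sub_pos.2 ht.2
    positivity
  refine ⟨hint, ?_⟩
  rw [intervalIntegral.integral_eq_sub_of_hasDerivAt_of_le zero_le_one hcont hderiv hint]
  rcases hx.eq_or_lt with rfl | hx
  · simp [F]
  · simp only [F, Real.log_div hx.ne' hy.ne']
    simp
    ring

/-- Comparison of all `χ²`-divergences along the segment implies comparison of relative
entropies. -/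
lemma sum_relEnt_le_of_chiSq {ι κ : Type*} [Fintype ι] [Fintype κ] {p q : ι → ℝ}
    {w x y : κ → ℝ} (hp : ∀ m, 0 ≤ p m) (hq : ∀ m, 0 ≤ q m) (hpq : ∀ m, q m = 0 → p m = 0)
    (hx : ∀ k, 0 ≤ x k) (hy : ∀ k, 0 ≤ y k) (hxy : ∀ k, y k = 0 → w k * x k = 0)
    (h : ∀ t ∈ Set.Ioo (0 : ℝ) 1,
      ∑ m, (p m - q m) ^ 2 / (t * p m + (1 - t) * q m) ≤
        ∑ k, w k * ((x k - y k) ^ 2 / (t * x k + (1 - t) * y k))) :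
    ∑ m, (p m * Real.log (p m / q m) - p m + q m) ≤
      ∑ k, w k * (x k * Real.log (x k / y k) - x k + y k) := by
  have hP := fun m => integral_chiSq (hp m) (hq m) (hpq m)
  have hQ : ∀ k, IntervalIntegrable
        (fun t : ℝ => w k * ((1 - t) * ((x k - y k) ^ 2 / (t * x k + (1 - t) * y k))))
        MeasureTheory.volume 0 1 ∧
      ∫ t in (0 : ℝ)..1, w k * ((1 - t) * ((x k - y k) ^ 2 / (t * x k + (1 - t) * y k))) =
        w k * (x k * Real.log (x k / y k) - x k + y k) := fun k => by
    by_cases hw : w k = 0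
    · simp [hw]
    · have := integral_chiSq (hx k) (hy k)
        (fun h0 => (mul_eq_zero.1 (hxy k h0)).resolve_left hw)
      exact ⟨this.1.const_mul _, by rw [intervalIntegral.integral_const_mul, this.2]⟩
  rw [← Finset.sum_congr rfl fun m _ => (hP m).2, ← Finset.sum_congr rfl fun k _ => (hQ k).2,
    ← intervalIntegral.integral_finsetSum fun m _ => (hP m).1,
    ← intervalIntegral.integral_finsetSum fun k _ => (hQ k).1]
  have hi₁ := IntervalIntegrable.sum Finset.univ fun m _ => (hP m).1
  have hi₂ := IntervalIntegrable.sum Finset.univ fun k _ => (hQ k).1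
  refine intervalIntegral.integral_mono_on_of_le_Ioo zero_le_one
    (by simpa only [Finset.sum_fn] using hi₁) (by simpa only [Finset.sum_fn] using hi₂) fun t ht => ?_
  have := mul_le_mul_of_nonneg_left (h t ht) (sub_nonneg.2 ht.2.le)
  simp only [Finset.mul_sum] at this
  refine this.trans_eq (Finset.sum_congr rfl fun k _ => by ring)

section Measurement

variable {n ι : Type} [Fintype n] [DecidableEq n] [Fintype ι]

open scoped MatrixOrder in
lemma trace_mul_nonneg {P R : Matrix n n ℂ} (hP : P.PosSemidef) (hR : R.PosSemidef) :
    0 ≤ (P * R).trace := by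
  obtain ⟨C, rfl⟩ := CStarAlgebra.nonneg_iff_eq_star_mul_self.mp hR.nonneg
  rw [← mul_assoc, trace_mul_comm, ← mul_assoc, star_eq_conjTranspose]
  exact (hP.mul_mul_conjTranspose_same C).trace_nonneg

lemma re_trace_mul_nonneg {P R : Matrix n n ℂ} (hP : P.PosSemidef) (hR : R.PosSemidef) :
    0 ≤ (P * R).trace.re :=
  (Complex.nonneg_iff.1 (trace_mul_nonneg hP hR)).1

lemma trace_mul_diagonal_mul (Y Z : Matrix n n ℂ) (d : n → ℂ) :
    (Y * diagonal d * Z).trace = ∑ i, ∑ j, Y j i * d i * Z i j := by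
  simp only [trace, diag_apply, Matrix.mul_apply (M := Y * diagonal d), mul_diagonal]
  exact Finset.sum_comm

/-- Operator Jensen inequality for the square: `(∑ xₘ Mₘ)² ≤ ∑ xₘ² Mₘ`. -/
lemma IsPOVM.posSemidef_sum_sq_sub {M : ι → Matrix n n ℂ} (hM : IsPOVM M) (x : ι → ℝ) :
    (∑ m, ((x m ^ 2 : ℝ) : ℂ) • M m -
      (∑ m, (x m : ℂ) • M m) * (∑ m, (x m : ℂ) • M m)).PosSemidef := by
  set X := ∑ m, (x m : ℂ) • M m with hX
  have hXh : Xᴴ = X := by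
    simp [hX, conjTranspose_sum, conjTranspose_smul, (hM.1 _).1.eq]
  have key : ∑ m, ((x m ^ 2 : ℝ) : ℂ) • M m - X * X =
      ∑ m, ((x m : ℂ) • 1 - X) * M m * ((x m : ℂ) • 1 - X)ᴴ := by
    have : ∀ m, ((x m : ℂ) • 1 - X) * M m * ((x m : ℂ) • 1 - X)ᴴ =
        ((x m ^ 2 : ℝ) : ℂ) • M m - ((x m : ℂ) • M m) * X - X * ((x m : ℂ) • M m)
          + X * M m * X := fun m => by
      rw [conjTranspose_sub, hXh]
      simp [sub_mul, mul_sub, pow_two, -Complex.coe_smul]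
      module
    simp only [this, Finset.sum_add_distrib, Finset.sum_sub_distrib, ← Finset.sum_mul,
      ← Finset.mul_sum, ← hX, hM.2]
    simp
  rw [key]
  exact posSemidef_sum _ fun m _ => (hM.1 m).mul_mul_conjTranspose_same _

lemma IsPOVM.re_trace_sq_mul_le {M : ι → Matrix n n ℂ} (hM : IsPOVM M) (x : ι → ℝ)
    {R : Matrix n n ℂ} (hR : R.PosSemidef) :
    ((∑ m, (x m : ℂ) • M m) * (∑ m, (x m : ℂ) • M m) * R).trace.re ≤
      ∑ m, x m ^ 2 * (M m * R).trace.re := by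
  have := re_trace_mul_nonneg (hM.posSemidef_sum_sq_sub x) hR
  rw [sub_mul, trace_sub, Complex.sub_re, sub_nonneg] at this
  refine this.trans_eq ?_
  simp only [Finset.sum_mul, trace_sum, Complex.re_sum, smul_mul_assoc, trace_smul, smul_eq_mul,
    Complex.re_ofReal_mul]

lemma posSemidef_mul_diagonal_mul {U : Matrix n n ℂ} {a : n → ℝ} (ha : ∀ i, 0 ≤ a i) :
    (U * diagonal (fun i => (a i : ℂ)) * Uᴴ).PosSemidef :=
  (PosSemidef.diagonal (by intro i; simpa using ha i)).mul_mul_conjTranspose_same U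

lemma two_mul_re_mul_sub_le (z g : ℂ) {a b d : ℝ} (hd : 0 ≤ d) (h0 : d = 0 → a = b) :
    2 * ((z * a * g).re - (z * b * g).re) ≤
      Complex.normSq g * ((a - b) ^ 2 / d) + d * Complex.normSq z := by
  rcases hd.eq_or_lt with rfl | hd
  · simp [h0 rfl]
  have h1 : (z * a * g).re - (z * b * g).re = (a - b) * (z.re * g.re - z.im * g.im) := by
    simp
    ring
  rw [h1, ← sub_nonneg]
  have : Complex.normSq g * ((a - b) ^ 2 / d) + d * Complex.normSq z -
      2 * ((a - b) * (z.re * g.re - z.im * g.im)) =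
      (((a - b) * g.re - d * z.re) ^ 2 + ((a - b) * g.im + d * z.im) ^ 2) / d := by
    simp only [Complex.normSq_apply]
    field_simp
    ring
  rw [this]
  positivity

/-- The `χ²`-divergences of two states, written in their eigenbases, do not increase under a
measurement. -/
lemma IsPOVM.sum_chiSq_le {M : ι → Matrix n n ℂ} (hM : IsPOVM M) {U V : Matrix n n ℂ}
    (hU : U * Uᴴ = 1) (hV : V * Vᴴ = 1) {a b : n → ℝ} (ha : ∀ i, 0 ≤ a i)
    (hb : ∀ i, 0 ≤ b i) {R S : Matrix n n ℂ}
    (hR : R = U * diagonal (fun i => (a i : ℂ)) * Uᴴ)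
    (hS : S = V * diagonal (fun i => (b i : ℂ)) * Vᴴ) {t : ℝ} (ht : t ∈ Set.Ioo (0 : ℝ) 1) :
    ∑ m, ((M m * R).trace.re - (M m * S).trace.re) ^ 2 /
        (t * (M m * R).trace.re + (1 - t) * (M m * S).trace.re) ≤
      ∑ k : n × n, Complex.normSq ((Uᴴ * V) k.1 k.2) *
        ((a k.1 - b k.2) ^ 2 / (t * a k.1 + (1 - t) * b k.2)) := by
  have hRp : R.PosSemidef := hR ▸ posSemidef_mul_diagonal_mul ha
  have hSp : S.PosSemidef := hS ▸ posSemidef_mul_diagonal_mul hb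
  set p : ι → ℝ := fun m => (M m * R).trace.re
  set q : ι → ℝ := fun m => (M m * S).trace.re
  have hp : ∀ m, 0 ≤ p m := fun m => re_trace_mul_nonneg (hM.1 m) hRp
  have hq : ∀ m, 0 ≤ q m := fun m => re_trace_mul_nonneg (hM.1 m) hSp
  have ht1 : 0 < 1 - t := sub_pos.2 ht.2
  have hzero : ∀ {u v : ℝ}, 0 ≤ u → 0 ≤ v → t * u + (1 - t) * v = 0 → u = v := by
    intro u v hu hv h
    have h1 := mul_nonneg ht.1.le hu
    have h2 := mul_nonneg ht1.le hv
    have h3 : t * u = 0 := by linarith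
    have h4 : (1 - t) * v = 0 := by linarith
    rw [(mul_eq_zero.1 h3).resolve_left ht.1.ne', (mul_eq_zero.1 h4).resolve_left ht1.ne']
  set x : ι → ℝ := fun m => (p m - q m) / (t * p m + (1 - t) * q m) with hx
  set X := ∑ m, (x m : ℂ) • M m with hX
  have hXh : Xᴴ = X := by
    simp [hX, conjTranspose_sum, conjTranspose_smul, (hM.1 _).1.eq]
  set Y := Vᴴ * X * U with hY
  set G := Uᴴ * V with hG
  have hlin : ∀ T : Matrix n n ℂ, (X * T).trace.re = ∑ m, x m * (M m * T).trace.re := by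
    intro T
    simp only [hX, Finset.sum_mul, trace_sum, Complex.re_sum, smul_mul_assoc, trace_smul,
      smul_eq_mul, Complex.re_ofReal_mul]
  have hXR : (X * R).trace = ∑ i, ∑ j, Y j i * a i * G i j := by
    rw [← trace_mul_diagonal_mul, hY, hG, hR, ← mul_assoc _ Uᴴ V, trace_mul_comm _ V]
    simp only [← mul_assoc, hV, one_mul]
  have hXS : (X * S).trace = ∑ i, ∑ j, Y j i * b j * G i j := by
    have : (X * S).trace = (G * diagonal (fun i => (b i : ℂ)) * Y).trace := by
      rw [hY, hG, hS, ← mul_assoc _ (Vᴴ * X) U, trace_mul_comm _ U, trace_mul_comm X]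
      simp only [← mul_assoc, hU, one_mul]
    rw [this, trace_mul_diagonal_mul, Finset.sum_comm]
    exact Finset.sum_congr rfl fun i _ => Finset.sum_congr rfl fun j _ => by ring
  have hXXR : (X * X * R).trace.re = ∑ i, ∑ j, a i * Complex.normSq (Y j i) := by
    have : (X * X * R).trace = (Y * diagonal (fun i => (a i : ℂ)) * Yᴴ).trace := by
      rw [hY, hR, conjTranspose_mul, conjTranspose_mul, conjTranspose_conjTranspose, hXh,
        trace_mul_comm (X * X), ← mul_assoc _ (Uᴴ), ← mul_assoc _ X V, trace_mul_comm _ V,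
        trace_mul_comm _ (X * X)]
      simp only [← mul_assoc, hV, one_mul]
      rw [trace_mul_comm _ X]
      simp only [← mul_assoc]
    rw [this, trace_mul_diagonal_mul, Complex.re_sum]
    refine Finset.sum_congr rfl fun i _ => ?_
    rw [Complex.re_sum]
    refine Finset.sum_congr rfl fun j _ => ?_
    simp [Complex.normSq_apply]
    ring
  have hXXS : (X * X * S).trace.re = ∑ i, ∑ j, b j * Complex.normSq (Y j i) := by
    have : (X * X * S).trace = (Yᴴ * diagonal (fun i => (b i : ℂ)) * Y).trace := by
      rw [hY, hS, conjTranspose_mul, conjTranspose_mul, conjTranspose_conjTranspose, hXh,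
        ← mul_assoc _ (Vᴴ * X) U, trace_mul_comm _ U]
      simp only [← mul_assoc, hU, one_mul]
      rw [trace_mul_comm _ X]
      simp only [← mul_assoc]
    rw [this, trace_mul_diagonal_mul, Complex.re_sum, Finset.sum_comm]
    simp only [Complex.re_sum]
    refine Finset.sum_congr rfl fun i _ => Finset.sum_congr rfl fun j _ => ?_
    simp [Complex.normSq_apply]
    ring
  have hclass : ∑ m, (p m - q m) ^ 2 / (t * p m + (1 - t) * q m) =
      2 * ((X * R).trace.re - (X * S).trace.re) -
        ∑ m, x m ^ 2 * (t * p m + (1 - t) * q m) := by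
    rw [hlin, hlin, ← Finset.sum_sub_distrib, Finset.mul_sum, ← Finset.sum_sub_distrib]
    refine Finset.sum_congr rfl fun m _ => ?_
    change _ = 2 * (x m * p m - x m * q m) - _
    simp only [hx]
    by_cases h0 : t * p m + (1 - t) * q m = 0
    · simp [h0]
    · field_simp
      ring
  have hquad : t * (X * X * R).trace.re + (1 - t) * (X * X * S).trace.re ≤
      ∑ m, x m ^ 2 * (t * p m + (1 - t) * q m) := by
    have h1 := mul_le_mul_of_nonneg_left (hM.re_trace_sq_mul_le x hRp) ht.1.le
    have h2 := mul_le_mul_of_nonneg_left (hM.re_trace_sq_mul_le x hSp) ht1.le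
    refine (add_le_add h1 h2).trans_eq ?_
    rw [Finset.mul_sum, Finset.mul_sum, ← Finset.sum_add_distrib]
    exact Finset.sum_congr rfl fun m _ => by ring
  have hsum : 2 * ((X * R).trace.re - (X * S).trace.re) ≤
      ∑ k : n × n, Complex.normSq (G k.1 k.2) *
        ((a k.1 - b k.2) ^ 2 / (t * a k.1 + (1 - t) * b k.2)) +
      (t * (X * X * R).trace.re + (1 - t) * (X * X * S).trace.re) := by
    rw [hXXR, hXXS, hXR, hXS]
    simp only [Complex.re_sum, Finset.mul_sum, ← Finset.sum_sub_distrib, Fintype.sum_prod_type,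
      ← Finset.sum_add_distrib]
    refine Finset.sum_le_sum fun i _ => Finset.sum_le_sum fun j _ => ?_
    have h1 := mul_nonneg ht.1.le (ha i)
    have h2 := mul_nonneg ht1.le (hb j)
    refine (two_mul_re_mul_sub_le (Y j i) (G i j) (add_nonneg h1 h2)
      (hzero (ha i) (hb j))).trans_eq ?_
    ring
  change ∑ m, (p m - q m) ^ 2 / (t * p m + (1 - t) * q m) ≤ _
  linarith

/-- A measurement does not increase the relative entropy: the right-hand side is
`Tr R log R - Tr R log S`, written in the eigenbases of `R` and `S`. -/
lemma IsPOVM.sum_mul_log_div_le {M : ι → Matrix n n ℂ} (hM : IsPOVM M) {U V : Matrix n n ℂ}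
    (hU : U * Uᴴ = 1) (hV : V * Vᴴ = 1) {a b : n → ℝ} (ha : ∀ i, 0 ≤ a i)
    (hb : ∀ i, 0 ≤ b i) {R S : Matrix n n ℂ}
    (hR : R = U * diagonal (fun i => (a i : ℂ)) * Uᴴ)
    (hS : S = V * diagonal (fun i => (b i : ℂ)) * Vᴴ)
    (htr : R.trace = S.trace) (hac : ∀ j, b j = 0 → ((Vᴴ * R * V) j j).re = 0)
    (hpq : ∀ m, (M m * S).trace.re = 0 → (M m * R).trace.re = 0) :
    ∑ m, (M m * R).trace.re * Real.log ((M m * R).trace.re / (M m * S).trace.re) ≤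
      ∑ i, a i * Real.log (a i) - ∑ j, ((Vᴴ * R * V) j j).re * Real.log (b j) := by
  have hU' : Uᴴ * U = 1 := mul_eq_one_comm.1 hU
  have hV' : Vᴴ * V = 1 := mul_eq_one_comm.1 hV
  have hRp : R.PosSemidef := hR ▸ posSemidef_mul_diagonal_mul ha
  have hSp : S.PosSemidef := hS ▸ posSemidef_mul_diagonal_mul hb
  set G := Uᴴ * V with hG
  have hGG : G * Gᴴ = 1 := by
    rw [hG, conjTranspose_mul, conjTranspose_conjTranspose, mul_assoc, ← mul_assoc V, hV,
      one_mul, hU']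
  have hGG' : Gᴴ * G = 1 := mul_eq_one_comm.1 hGG
  have hrow : ∀ i, ∑ j, Complex.normSq (G i j) = 1 := fun i => by
    have := congrArg Complex.re (congrFun (congrFun hGG i) i)
    simpa [Matrix.mul_apply, Complex.mul_conj] using this
  have hcol : ∀ j, ∑ i, Complex.normSq (G i j) = 1 := fun j => by
    have := congrArg Complex.re (congrFun (congrFun hGG' j) j)
    simpa [Matrix.mul_apply, mul_comm _ (G _ _), Complex.mul_conj] using this
  have hdiag : ∀ j, ((Vᴴ * R * V) j j).re = ∑ i, Complex.normSq (G i j) * a i := fun j => by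
    have : Vᴴ * R * V = Gᴴ * diagonal (fun i => (a i : ℂ)) * G := by
      rw [hG, hR, conjTranspose_mul, conjTranspose_conjTranspose]
      simp only [mul_assoc]
    rw [this, Matrix.mul_apply, Complex.re_sum]
    refine Finset.sum_congr rfl fun i _ => ?_
    rw [mul_diagonal]
    simp [Complex.normSq_apply]
    ring
  have hW : ∀ i j, b j = 0 → Complex.normSq (G i j) * a i = 0 := fun i j hj => by
    have := hac j hj
    rw [hdiag, Finset.sum_eq_zero_iff_of_nonneg
      fun i _ => mul_nonneg (Complex.normSq_nonneg _) (ha i)] at this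
    exact this i (Finset.mem_univ i)
  have htr' : ∑ i, a i = ∑ j, b j := by
    rw [hR, hS, trace_mul_comm, trace_mul_comm (V * _), ← mul_assoc, ← mul_assoc, hU', hV',
      one_mul, one_mul, trace_diagonal, trace_diagonal] at htr
    exact_mod_cast htr
  have hmass : ∀ T : Matrix n n ℂ, ∑ m, (M m * T).trace.re = T.trace.re := fun T => by
    rw [← Complex.re_sum, ← trace_sum, ← Finset.sum_mul, hM.2, one_mul]
  have main := sum_relEnt_le_of_chiSq (w := fun k : n × n => Complex.normSq (G k.1 k.2))
    (x := fun k => a k.1) (y := fun k => b k.2)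
    (fun m => re_trace_mul_nonneg (hM.1 m) hRp) (fun m => re_trace_mul_nonneg (hM.1 m) hSp) hpq
    (fun k => ha k.1) (fun k => hb k.2) (fun k => hW k.1 k.2)
    (fun t ht => hM.sum_chiSq_le hU hV ha hb hR hS ht)
  rw [Finset.sum_add_distrib, Finset.sum_sub_distrib, hmass, hmass, htr, sub_add_cancel] at main
  refine main.trans_eq ?_
  have hterm : ∀ i j, Complex.normSq (G i j) * (a i * Real.log (a i / b j) - a i + b j) =
      Complex.normSq (G i j) * (a i * Real.log (a i))
        - Complex.normSq (G i j) * a i * Real.log (b j)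
        - Complex.normSq (G i j) * a i + Complex.normSq (G i j) * b j := fun i j => by
    by_cases h0 : Complex.normSq (G i j) * a i = 0
    · linear_combination (Real.log (a i / b j) - Real.log (a i)) * h0 +
        Real.log (b j) * h0
    · have hb0 : b j ≠ 0 := fun h => h0 (hW i j h)
      rw [Real.log_div (right_ne_zero_of_mul h0) hb0]
      ring
  simp only [Fintype.sum_prod_type, hterm, Finset.sum_add_distrib, Finset.sum_sub_distrib,
    ← Finset.sum_mul, hrow, one_mul, hdiag]
  have hb' : ∑ i, ∑ j, Complex.normSq (G i j) * b j = ∑ j, b j := by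
    rw [Finset.sum_comm]
    simp only [← Finset.sum_mul, hcol, one_mul]
  have hlog : ∑ i, ∑ j, Complex.normSq (G i j) * a i * Real.log (b j) =
      ∑ j, (∑ i, Complex.normSq (G i j) * a i) * Real.log (b j) := by
    rw [Finset.sum_comm]
    simp only [← Finset.sum_mul]
  rw [hb', hlog, htr']
  ring

lemma IsDensity.exists_eigenbasis {ρ : Matrix n n ℂ} (hρ : IsDensity ρ) :
    ∃ (U : Matrix n n ℂ) (a : n → ℝ), U * Uᴴ = 1 ∧ (∀ i, 0 ≤ a i) ∧
      ρ = U * diagonal (fun i => (a i : ℂ)) * Uᴴ ∧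
      vN ρ = ∑ i, -(a i * Real.logb 2 (a i)) := by
  have h := hρ.1.1
  refine ⟨h.eigenvectorUnitary, h.eigenvalues, ?_, hρ.1.eigenvalues_nonneg, ?_, ?_⟩
  · exact Unitary.mul_star_self_of_mem h.eigenvectorUnitary.2
  · conv_lhs => rw [h.spectral_theorem, Unitary.conjStarAlgAut_apply]
    rfl
  · rw [vN, dif_pos h]

end Measurement

section Bipartite

variable {A B J K : Type} [Fintype A] [Fintype B] [Fintype J] [Fintype K]

lemma trace_kronecker_one_mul [DecidableEq B] (N : Matrix A A ℂ) (R : Matrix (A × B) (A × B) ℂ) :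
    ((N ⊗ₖ (1 : Matrix B B ℂ)) * R).trace = (N * trOutB R).trace := by
  simp only [trace, diag_apply, Matrix.mul_apply, Fintype.sum_prod_type, kroneckerMap_apply,
    one_apply, trOutB, of_apply, mul_ite, mul_one, mul_zero, ite_mul, zero_mul,
    Finset.sum_ite_eq, Finset.mem_univ, if_true, Finset.mul_sum]
  exact Finset.sum_congr rfl fun a _ => Finset.sum_comm

lemma trace_one_kronecker_mul [DecidableEq A] (N : Matrix B B ℂ) (R : Matrix (A × B) (A × B) ℂ) :
    (((1 : Matrix A A ℂ) ⊗ₖ N) * R).trace = (N * trOutA R).trace := by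
  have h : ∀ (a a' : A) (x y : ℂ), (if a = a' then (1 : ℂ) else 0) * x * y =
      if a = a' then x * y else 0 := fun a a' x y => by split_ifs <;> simp
  simp only [trace, diag_apply, Matrix.mul_apply, Fintype.sum_prod_type, kroneckerMap_apply,
    one_apply, trOutA, of_apply, h, Finset.mul_sum]
  rw [Finset.sum_comm]
  refine Finset.sum_congr rfl fun b _ => ?_
  rw [Finset.sum_comm (γ := B)]
  refine Finset.sum_congr rfl fun a _ => ?_
  rw [Finset.sum_comm]
  simp

lemma trOutB_conj [DecidableEq B] {C : Matrix A A ℂ} {D : Matrix B B ℂ} (hD : D * Dᴴ = 1)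
    (R : Matrix (A × B) (A × B) ℂ) :
    trOutB ((C ⊗ₖ D)ᴴ * R * (C ⊗ₖ D)) = Cᴴ * trOutB R * C := by
  refine ext_iff_trace_mul_left.2 fun N => ?_
  rw [← trace_kronecker_one_mul, ← mul_assoc, trace_mul_comm, conjTranspose_kronecker,
    ← mul_assoc, ← mul_assoc, ← mul_assoc, ← mul_kronecker_mul, ← mul_kronecker_mul, mul_one, hD,
    trace_kronecker_one_mul, ← mul_assoc, trace_mul_comm _ C]
  simp only [← mul_assoc]

lemma trOutA_conj [DecidableEq A] {C : Matrix A A ℂ} {D : Matrix B B ℂ} (hC : C * Cᴴ = 1)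
    (R : Matrix (A × B) (A × B) ℂ) :
    trOutA ((C ⊗ₖ D)ᴴ * R * (C ⊗ₖ D)) = Dᴴ * trOutA R * D := by
  refine ext_iff_trace_mul_left.2 fun N => ?_
  rw [← trace_one_kronecker_mul, ← mul_assoc, trace_mul_comm, conjTranspose_kronecker,
    ← mul_assoc, ← mul_assoc, ← mul_assoc, ← mul_kronecker_mul, ← mul_kronecker_mul, mul_one, hC,
    trace_one_kronecker_mul, ← mul_assoc, trace_mul_comm _ D]
  simp only [← mul_assoc]

lemma IsDensity.trOutB [DecidableEq A] [DecidableEq B]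
    {ρ : Matrix (A × B) (A × B) ℂ} (hρ : IsDensity ρ) :
    IsDensity (trOutB ρ) := by
  constructor
  · have : _root_.trOutB ρ = ∑ b, ρ.submatrix (fun a => (a, b)) (fun a => (a, b)) := by
      ext a a'
      simp [_root_.trOutB, Matrix.sum_apply]
    rw [this]
    exact posSemidef_sum _ fun b _ => hρ.1.submatrix _
  · simpa [hρ.2] using (trace_kronecker_one_mul 1 ρ).symm

lemma IsDensity.trOutA [DecidableEq A] [DecidableEq B]
    {ρ : Matrix (A × B) (A × B) ℂ} (hρ : IsDensity ρ) :
    IsDensity (trOutA ρ) := by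
  constructor
  · have : _root_.trOutA ρ = ∑ a, ρ.submatrix (fun b => (a, b)) (fun b => (a, b)) := by
      ext b b'
      simp [_root_.trOutA, Matrix.sum_apply]
    rw [this]
    exact posSemidef_sum _ fun b _ => hρ.1.submatrix _
  · simpa [hρ.2] using (trace_one_kronecker_mul 1 ρ).symm

lemma IsPOVM.kronecker [DecidableEq A] [DecidableEq B]
    {MA : J → Matrix A A ℂ} {MB : K → Matrix B B ℂ}
    (hMA : IsPOVM MA) (hMB : IsPOVM MB) :
    IsPOVM fun jk : J × K => MA jk.1 ⊗ₖ MB jk.2 := by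
  refine ⟨fun jk => (hMA.1 _).kronecker (hMB.1 _), ?_⟩
  have h := congrArg₂ (fun (P : Matrix A A ℂ) (Q : Matrix B B ℂ) => P ⊗ₖ Q) hMA.2 hMB.2
  rw [← one_kronecker_one, ← h]
  ext ⟨a, b⟩ ⟨a', b'⟩
  simp [Matrix.sum_apply, Fintype.sum_prod_type, Finset.sum_mul_sum]

lemma margA_outcomeProb [DecidableEq B] (ρ : Matrix (A × B) (A × B) ℂ) (MA : J → Matrix A A ℂ)
    {MB : K → Matrix B B ℂ} (hMB : IsPOVM MB) (j : J) :
    margA (outcomeProb ρ MA MB) j = (MA j * trOutB ρ).trace.re := by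
  have h : MA j ⊗ₖ (1 : Matrix B B ℂ) = ∑ k, MA j ⊗ₖ MB k := by
    rw [← hMB.2]
    ext
    simp [Matrix.sum_apply, Finset.mul_sum]
  rw [← trace_kronecker_one_mul, h, Finset.sum_mul, trace_sum, Complex.re_sum]
  rfl

lemma margB_outcomeProb [DecidableEq A] (ρ : Matrix (A × B) (A × B) ℂ) {MA : J → Matrix A A ℂ}
    (MB : K → Matrix B B ℂ) (hMA : IsPOVM MA) (k : K) :
    margB (outcomeProb ρ MA MB) k = (MB k * trOutA ρ).trace.re := by
  have h : (1 : Matrix A A ℂ) ⊗ₖ MB k = ∑ j, MA j ⊗ₖ MB k := by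
    rw [← hMA.2]
    ext
    simp [Matrix.sum_apply, Finset.sum_mul]
  rw [← trace_one_kronecker_mul, h, Finset.sum_mul, trace_sum, Complex.re_sum]
  rfl

end Bipartite

lemma eq_zero_of_margA_mul_margB {α β : Type} [Fintype α] [Fintype β] {p : α × β → ℝ}
    (hp : ∀ x, 0 ≤ p x) {a : α} {b : β} (h : margA p a * margB p b = 0) : p (a, b) = 0 := by
  rcases mul_eq_zero.1 h with h | h
  · exact (Finset.sum_eq_zero_iff_of_nonneg fun b _ => hp (a, b)).1 h b (Finset.mem_univ b)
  · exact (Finset.sum_eq_zero_iff_of_nonneg fun a _ => hp (a, b)).1 h a (Finset.mem_univ a)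

lemma sum_mul_logb_margA_mul_margB {α β : Type} [Fintype α] [Fintype β] {p : α × β → ℝ}
    (hp : ∀ x, 0 ≤ p x) :
    ∑ x, p x * Real.logb 2 (margA p x.1 * margB p x.2) =
      -H2 (margA p) - H2 (margB p) := by
  have h : ∀ x : α × β, p x * Real.logb 2 (margA p x.1 * margB p x.2) =
      p x * Real.logb 2 (margA p x.1) + p x * Real.logb 2 (margB p x.2) := fun x => by
    by_cases h0 : margA p x.1 * margB p x.2 = 0
    · simp [eq_zero_of_margA_mul_margB hp h0]
    · rw [Real.logb_mul (left_ne_zero_of_mul h0) (right_ne_zero_of_mul h0), mul_add]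
  simp only [h, Finset.sum_add_distrib, H2, Finset.sum_neg_distrib, neg_neg, sub_neg_eq_add]
  congr 1
  · simp only [Fintype.sum_prod_type, ← Finset.sum_mul, margA]
  · simp only [Fintype.sum_prod_type_right, ← Finset.sum_mul, margB]

lemma klDiv_margA_mul_margB {α β : Type} [Fintype α] [Fintype β] {p : α × β → ℝ}
    (hp : ∀ x, 0 ≤ p x) :
    klDiv p (fun x => margA p x.1 * margB p x.2) = mi p := by
  have h : ∀ x : α × β, p x * Real.logb 2 (p x / (margA p x.1 * margB p x.2)) =
      p x * Real.logb 2 (p x) - p x * Real.logb 2 (margA p x.1 * margB p x.2) := fun x => by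
    by_cases h0 : p x = 0
    · simp [h0]
    · rw [Real.logb_div h0 fun h => h0 (eq_zero_of_margA_mul_margB hp h), mul_sub]
  rw [klDiv, Finset.sum_congr rfl fun x _ => h x, Finset.sum_sub_distrib,
    sum_mul_logb_margA_mul_margB hp, mi, H2, H2, H2]
  simp only [Finset.sum_neg_distrib]
  ring

section LocalMeasurement

variable {A B J K : Type} [Fintype A] [DecidableEq A] [Fintype B] [DecidableEq B]
  [Fintype J] [Fintype K]

lemma outcomeProb_nonneg {ρ : Matrix (A × B) (A × B) ℂ} (hρ : IsDensity ρ)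
    {MA : J → Matrix A A ℂ} {MB : K → Matrix B B ℂ} (hMA : IsPOVM MA) (hMB : IsPOVM MB)
    (x : J × K) : 0 ≤ outcomeProb ρ MA MB x :=
  re_trace_mul_nonneg ((hMA.kronecker hMB).1 x) hρ.1

/-- Local measurements do not increase the mutual information. -/
lemma klDiv_outcomeProb_le {ρ : Matrix (A × B) (A × B) ℂ} (hρ : IsDensity ρ)
    {MA : J → Matrix A A ℂ} {MB : K → Matrix B B ℂ} (hMA : IsPOVM MA) (hMB : IsPOVM MB) :
    klDiv (outcomeProb ρ MA MB)
      (fun jk => margA (outcomeProb ρ MA MB) jk.1 * margB (outcomeProb ρ MA MB) jk.2) ≤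
        Iq ρ := by
  obtain ⟨U, a, hU, ha, hR, hvN⟩ := hρ.exists_eigenbasis
  obtain ⟨C, c, hC, hc, hRA, hvNA⟩ := hρ.trOutB.exists_eigenbasis
  obtain ⟨D, d, hD, hd, hRB, hvNB⟩ := hρ.trOutA.exists_eigenbasis
  have hV : (C ⊗ₖ D) * (C ⊗ₖ D)ᴴ = 1 := by
    rw [conjTranspose_kronecker, ← mul_kronecker_mul, hC, hD, one_kronecker_one]
  have hS : trOutB ρ ⊗ₖ trOutA ρ = (C ⊗ₖ D) *
      diagonal (fun x : A × B => ((c x.1 * d x.2 : ℝ) : ℂ)) * (C ⊗ₖ D)ᴴ := by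
    conv_lhs => rw [hRA, hRB]
    rw [mul_kronecker_mul, mul_kronecker_mul, diagonal_kronecker_diagonal,
      conjTranspose_kronecker]
    simp only [Complex.ofReal_mul]
  set T := (C ⊗ₖ D)ᴴ * ρ * (C ⊗ₖ D) with hT
  set r : A × B → ℝ := fun x => (T x x).re with hr
  have hTp : T.PosSemidef := hρ.1.conjTranspose_mul_mul_same _
  have hr0 : ∀ x, 0 ≤ r x := fun x => (Complex.nonneg_iff.1 hTp.diag_nonneg).1
  have hunconj : ∀ {m : Type} [Fintype m] [DecidableEq m] {P Q : Matrix m m ℂ} {e : m → ℝ},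
      P * Pᴴ = 1 → Q = P * diagonal (fun i => (e i : ℂ)) * Pᴴ →
      Pᴴ * Q * P = diagonal (fun i => (e i : ℂ)) := by
    intro m _ _ P Q e hP hQ
    have hP' : Pᴴ * P = 1 := mul_eq_one_comm.1 hP
    rw [hQ, mul_assoc, mul_assoc, hP', mul_one, ← mul_assoc, hP', one_mul]
  have hrA : margA r = c := by
    ext x
    have := congrArg Complex.re (congrFun (congrFun (trOutB_conj (C := C) hD ρ) x) x)
    rw [hunconj hC hRA, ← hT] at this
    simpa [trOutB, margA, hr] using this
  have hrB : margB r = d := by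
    ext x
    have := congrArg Complex.re (congrFun (congrFun (trOutA_conj (D := D) hC ρ) x) x)
    rw [hunconj hD hRB, ← hT] at this
    simpa [trOutA, margB, hr] using this
  set p := outcomeProb ρ MA MB with hp
  have hp0 : ∀ x, 0 ≤ p x := outcomeProb_nonneg hρ hMA hMB
  have hq : ∀ x : J × K, ((MA x.1 ⊗ₖ MB x.2) * (trOutB ρ ⊗ₖ trOutA ρ)).trace.re =
      margA p x.1 * margB p x.2 := fun x => by
    have him := (Complex.nonneg_iff.1 (trace_mul_nonneg (hMA.1 x.1) hρ.trOutB.1)).2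
    rw [← mul_kronecker_mul, trace_kronecker, margA_outcomeProb ρ MA hMB,
      margB_outcomeProb ρ MB hMA, Complex.mul_re, ← him, zero_mul, sub_zero]
  have main := (hMA.kronecker hMB).sum_mul_log_div_le hU hV ha
    (fun x => mul_nonneg (hc x.1) (hd x.2)) hR hS
    (by rw [trace_kronecker, hρ.2, hρ.trOutB.2, hρ.trOutA.2, one_mul])
    (fun x hx => by
      rw [← hrA, ← hrB] at hx
      exact eq_zero_of_margA_mul_margB hr0 hx)
    (fun x hx => by
      rw [hq] at hx
      exact eq_zero_of_margA_mul_margB hp0 hx)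
  simp only [hq] at main
  have hlog : 0 < Real.log 2 := Real.log_pos one_lt_two
  have hrlog := sum_mul_logb_margA_mul_margB hr0
  rw [hrA, hrB] at hrlog
  have main' := div_le_div_of_nonneg_right main hlog.le
  rw [sub_div, Finset.sum_div, Finset.sum_div, Finset.sum_div] at main'
  simp only [mul_div_assoc, Real.log_div_log] at main'
  refine main'.trans_eq ?_
  change _ - ∑ x, r x * Real.logb 2 (c x.1 * d x.2) = _
  rw [hrlog, Iq, hvN, hvNA, hvNB, H2, H2, Finset.sum_neg_distrib (f := fun i => a i * _)]
  ring

end LocalMeasurement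

/-- for any local POVM on a bipartite density matrix, the relative entropy
of the outcome distribution to the product of its marginals is at most the quantum mutual
information `I_q(ρ)`; in particular `I_c(ρ) ≤ I_q(ρ)`. -/
theorem stmt_12 {A B J K : Type} [Fintype A] [DecidableEq A] [Fintype B] [DecidableEq B]
    [Fintype J] [Fintype K]
    (ρ : Matrix (A × B) (A × B) ℂ) (hρ : IsDensity ρ)
    (MA : J → Matrix A A ℂ) (MB : K → Matrix B B ℂ)
    (hMA : IsPOVM MA) (hMB : IsPOVM MB) :
    klDiv (outcomeProb ρ MA MB)
        (fun jk => margA (outcomeProb ρ MA MB) jk.1 *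
                   margB (outcomeProb ρ MA MB) jk.2) ≤ Iq ρ ∧
    Ic ρ ≤ Iq ρ := by
  refine ⟨klDiv_outcomeProb_le hρ hMA hMB, csSup_le ⟨_, J, K, _, _, MA, MB, hMA, hMB, rfl⟩ ?_⟩
  rintro _ ⟨J', K', _, _, MA', MB', hMA', hMB', rfl⟩
  rw [← klDiv_margA_mul_margB (outcomeProb_nonneg hρ hMA' hMB')]
  exact klDiv_outcomeProb_le hρ hMA' hMB'

end
end
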